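/- Let y ∈ X and let k ≥ 0 be such that B_{k,i} ≠ ∅ for all i = 1,…,m, and suppose each x_{k−l} for 0 ≤ l ≤ min(k, W−1) satisfies ‖x_k − x_{k−l}‖ ≤ t̄_{k−W,k−1} · m · C · W, where t̄_{k−W,k−1} = max{t_{k−W}, …, t_{k−1}} (with t_i = t_0 for i < 0). Then −2 t_k Σ_{i=1}^m Σ_{l ∈ B_{k,i}} α_{k,i,l} ⟨g_i(x_{k−l}), x_k − y⟩ ≤ −2 t_k ( f(x_k) − f(y) ) + 4 t_k t̄_{k−W,k−1} m² C² W, where f = Σ_{i=1}^m f_i. -/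

import Mathlib

open RealInnerProductSpace

lemma exists_subgradient_aux {n : ℕ} (f : EuclideanSpace ℝ (Fin n) → ℝ)
    (hf : ConvexOn ℝ Set.univ f) (z : EuclideanSpace ℝ (Fin n)) :
    ∃ g : EuclideanSpace ℝ (Fin n), ∀ y, f z + ⟪g, y - z⟫ ≤ f y := by
  have hcont : Continuous f := hf.locallyLipschitz.continuous
  have hopen : IsOpen {p : EuclideanSpace ℝ (Fin n) × ℝ | p.1 ∈ Set.univ ∧ f p.1 < p.2} := by
    simp only [Set.mem_univ, true_and]
    exact isOpen_lt (by fun_prop) (by fun_prop)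
  obtain ⟨L, hL⟩ := geometric_hahn_banach_open_point (x := (z, f z))
    hf.convex_strict_epigraph hopen (by simp)
  have hdec : ∀ w s, L (w, s) = L (w, 0) + s * L (0, 1) := by
    intro w s
    have h : ((w, s) : EuclideanSpace ℝ (Fin n) × ℝ) = (w, 0) + s • (0, 1) := by
      ext <;> simp
    rw [h, map_add, map_smul, smul_eq_mul]
  have hc : L (0, 1) < 0 := by
    have h := hL (z, f z + 1) (by simp)
    rw [hdec z (f z + 1), hdec z (f z)] at h
    linarith
  set c : ℝ := -L (0, 1) with hcdef
  have hcpos : 0 < c := by linarith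
  let u : StrongDual ℝ (EuclideanSpace ℝ (Fin n)) :=
    L.comp (ContinuousLinearMap.inl ℝ (EuclideanSpace ℝ (Fin n)) ℝ)
  have hu : ∀ w, u w = L (w, 0) := fun w => by simp [u]
  refine ⟨(InnerProductSpace.toDual ℝ _).symm (c⁻¹ • u), fun w => ?_⟩
  rw [InnerProductSpace.toDual_symm_apply]
  have hkey : u w - u z ≤ c * (f w - f z) := by
    refine le_of_forall_pos_le_add fun ε hε => ?_
    have h := hL (w, f w + ε / c) (by simp; positivity)
    rw [hdec w, hdec z (f z), ← hu, ← hu] at h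
    have h1 : L (0, 1) = -c := by simp [hcdef]
    rw [h1] at h
    have h2 : ε / c * c = ε := by field_simp
    nlinarith
  have h3 : (c⁻¹ • u) (w - z) ≤ f w - f z := by
    simp only [smul_apply, map_sub, smul_eq_mul]
    rw [← mul_sub, inv_mul_le_iff₀ hcpos]
    exact hkey
  linarith


/-- Let `y ∈ X` and `k` be such that every `B k i` is nonempty,
and suppose `‖x k - x (k - l)‖ ≤ t̄ * m * C * W` for all `0 ≤ l ≤ min k (W-1)`,
where `t̄ = max{t (k-W), …, t (k-1)}` (with `t i = t 0` for `i < 0`, realized by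
truncated subtraction on `ℕ`). Then
`-2 t k ∑ i ∑ l α k i l ⟪g i (k-l), x k - y⟫
  ≤ -2 t k (f (x k) - f y) + 4 t k t̄ m² C² W`. -/
theorem incremental_cp_inner_product_sum_bound
    (n m W : ℕ) (hW : 1 ≤ W)
    (X : Set (EuclideanSpace ℝ (Fin n)))
    (hXne : X.Nonempty) (hXclosed : IsClosed X) (hXconvex : Convex ℝ X)
    (f : Fin m → EuclideanSpace ℝ (Fin n) → ℝ)
    (hfconv : ∀ i, ConvexOn ℝ Set.univ (f i))
    (C : ℝ) (hC : 0 < C)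
    -- every subgradient of any `f i` at any point of `X` has norm at most `C`
    (hCbound : ∀ i, ∀ z ∈ X, ∀ g : EuclideanSpace ℝ (Fin n),
      (∀ y, f i z + ⟪g, y - z⟫ ≤ f i y) → ‖g‖ ≤ C)
    -- positive step sizes
    (t : ℕ → ℝ) (ht : ∀ k, 0 < t k)
    -- the iterates, lying in `X`
    (x : ℕ → EuclideanSpace ℝ (Fin n)) (hx : ∀ k, x k ∈ X)
    -- the index sets `B k i ⊆ {0, …, min k (W-1)}`
    (B : ℕ → Fin m → Finset ℕ)
    (hB : ∀ k i, ∀ l ∈ B k i, l ≤ min k (W - 1))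
    -- `g i j` is a subgradient of `f i` at `x j` (used for `j = k - l`, `l ∈ B k i`)
    (g : Fin m → ℕ → EuclideanSpace ℝ (Fin n))
    (hg : ∀ k i, ∀ l ∈ B k i, ∀ y,
      f i (x (k - l)) + ⟪g i (k - l), y - x (k - l)⟫ ≤ f i y)
    -- convex weights
    (α : ℕ → Fin m → ℕ → ℝ)
    (hα0 : ∀ k i l, 0 ≤ α k i l)
    (hα1 : ∀ k i, (B k i).Nonempty → ∑ l ∈ B k i, α k i l = 1)
    -- the iteration index and the point `y`
    (k : ℕ) (hk : ∀ i, (B k i).Nonempty)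
    (y : EuclideanSpace ℝ (Fin n)) (hy : y ∈ X)
    -- `t̄ = max{t (k-W), …, t (k-1)}`
    (tbar : ℝ)
    (htbar : tbar =
      (Finset.Icc (k - W) (k - 1)).sup' (Finset.nonempty_Icc.mpr (by omega)) t)
    -- the distance assumption on the recent iterates
    (hdist : ∀ l ≤ min k (W - 1),
      ‖x k - x (k - l)‖ ≤ tbar * (m : ℝ) * C * (W : ℝ)) :
    -2 * t k *
        (∑ i : Fin m, ∑ l ∈ B k i, α k i l * ⟪g i (k - l), x k - y⟫) ≤
      -2 * t k * ((∑ i : Fin m, f i (x k)) - ∑ i : Fin m, f i y) +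
        4 * t k * tbar * (m : ℝ) ^ 2 * C ^ 2 * (W : ℝ) := by
  set D : ℝ := tbar * (m : ℝ) * C * (W : ℝ) with hD
  have hterm : ∀ i, ∀ l ∈ B k i,
      f i (x k) - f i y - 2 * (C * D) ≤ ⟪g i (k - l), x k - y⟫ := by
    intro i l hl
    have hd := hdist l (hB k i l hl)
    have hgn : ‖g i (k - l)‖ ≤ C := hCbound i _ (hx _) _ (hg k i l hl)
    obtain ⟨s, hs⟩ := exists_subgradient_aux (f i) (hfconv i) (x k)
    have hsn : ‖s‖ ≤ C := hCbound i _ (hx _) _ hs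
    have h1 := hs (x (k - l))
    have h2 := hg k i l hl y
    have h3 : ⟪g i (k - l), x k - y⟫ =
        ⟪g i (k - l), x k - x (k - l)⟫ - ⟪g i (k - l), y - x (k - l)⟫ := by
      rw [← inner_sub_right]; congr 1; abel
    have h4 : |⟪g i (k - l), x k - x (k - l)⟫| ≤ C * D :=
      (abs_real_inner_le_norm _ _).trans (mul_le_mul hgn hd (norm_nonneg _) hC.le)
    have h5 : |⟪s, x (k - l) - x k⟫| ≤ C * D := by
      refine (abs_real_inner_le_norm _ _).trans (mul_le_mul hsn ?_ (norm_nonneg _) hC.le)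
      rw [norm_sub_rev]; exact hd
    have h6 := (abs_le.mp h4).1
    have h7 := (abs_le.mp h5).1
    linarith
  have hi : ∀ i, f i (x k) - f i y - 2 * (C * D) ≤
      ∑ l ∈ B k i, α k i l * ⟪g i (k - l), x k - y⟫ := by
    intro i
    calc f i (x k) - f i y - 2 * (C * D)
        = ∑ l ∈ B k i, α k i l * (f i (x k) - f i y - 2 * (C * D)) := by
          rw [← Finset.sum_mul, hα1 k i (hk i), one_mul]
      _ ≤ _ := Finset.sum_le_sum fun l hl =>
          mul_le_mul_of_nonneg_left (hterm i l hl) (hα0 k i l)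
  have hsum := Finset.sum_le_sum fun i (_ : i ∈ Finset.univ) => hi i
  rw [Finset.sum_sub_distrib, Finset.sum_sub_distrib, Finset.sum_const, Finset.card_univ,
    Fintype.card_fin, nsmul_eq_mul] at hsum
  have hfin := mul_le_mul_of_nonneg_left hsum (mul_pos two_pos (ht k)).le
  rw [hD] at hfin
  linarith
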